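/- arXiv:1601.07087 — 2 statements merged into one kernel-verified Lean document; each statement's English description precedes it below -/
import Mathlib

section
/- Let y₁,…,y_m be independent real Gaussian random variables with mean 0 and variance σ², and set z := Σ_{i=1}^m (y_i² − σ²). Then (i) for every t ∈ ℝ and every u with −1/(2σ²) < u < 0, P(z ≤ t) ≤ exp(m σ⁴ u² − u t); and (ii) for every x with 0 < x < m/4, P(z ≤ −2σ²√(m x)) ≤ e^{−x}. -/
open MeasureTheory ProbabilityTheory

noncomputable section

lemma aux_int (σ u : ℝ) (v : NNReal) (hvs : (v : ℝ) = σ ^ 2) (hσ : 0 < σ) (hu : u < 0) :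
    ∫ y, Real.exp (u * (y ^ 2 - σ ^ 2)) ∂(gaussianReal 0 v)
      ≤ Real.exp (σ ^ 4 * u ^ 2) := by
  have hv : v ≠ 0 := by
    rintro rfl
    have : 0 < σ ^ 2 := by positivity
    rw [← hvs] at this
    simp at this
  have hpi := Real.pi_pos
  rw [integral_gaussianReal_eq_integral_smul hv]
  have h1 : ∀ y : ℝ, gaussianPDFReal 0 v y • Real.exp (u * (y ^ 2 - σ ^ 2))
      = ((√(2 * Real.pi * σ ^ 2))⁻¹ * Real.exp (-u * σ ^ 2)) *
        Real.exp (-(1 / (2 * σ ^ 2) - u) * y ^ 2) := by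
    intro y
    simp only [gaussianPDFReal, smul_eq_mul, hvs]
    rw [mul_assoc, mul_assoc (√(2 * Real.pi * σ ^ 2))⁻¹, ← Real.exp_add, ← Real.exp_add]
    congr 2
    field_simp
    ring
  simp_rw [h1]
  rw [integral_const_mul, integral_gaussian]
  set a := -u * σ ^ 2 with ha
  have ha0 : 0 < a := mul_pos (by linarith) (by positivity)
  have h2 : Real.pi / (1 / (2 * σ ^ 2) - u) = (2 * Real.pi * σ ^ 2) * (1 + 2 * a)⁻¹ := by
    have : (1 / (2 * σ ^ 2) - u) = (1 + 2 * a) / (2 * σ ^ 2) := by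
      rw [ha]; field_simp; ring
    rw [this]; field_simp
  have hs : 0 < √(2 * Real.pi * σ ^ 2) := Real.sqrt_pos.mpr (by positivity)
  rw [h2, Real.sqrt_mul (x := 2 * Real.pi * σ ^ 2) (by positivity) (1 + 2 * a)⁻¹, Real.sqrt_inv]
  have h3 : σ ^ 4 * u ^ 2 = a ^ 2 := by rw [ha]; ring
  rw [h3]
  have h4 : Real.exp (a - a ^ 2) ≤ √(1 + 2 * a) := by
    apply Real.le_sqrt_of_sq_le
    rw [← Real.exp_nat_mul, ← Real.le_log_iff_exp_le (by linarith)]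
    refine le_trans ?_ (Real.le_log_one_add_of_nonneg (x := 2 * a) (by linarith))
    rw [le_div_iff₀ (by linarith)]
    push_cast
    nlinarith [pow_pos ha0 3]
  have hq : 0 < √(1 + 2 * a) := Real.sqrt_pos.mpr (by linarith)
  have h5 : (√(2 * Real.pi * σ ^ 2))⁻¹ * Real.exp a * (√(2 * Real.pi * σ ^ 2) * (√(1 + 2 * a))⁻¹)
      = Real.exp a / √(1 + 2 * a) := by field_simp
  rw [h5, div_le_iff₀ hq]
  calc Real.exp a = Real.exp (a ^ 2) * Real.exp (a - a ^ 2) := by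
        rw [← Real.exp_add]; congr 1; ring
    _ ≤ _ := by gcongr

lemma aux_i (m : ℕ) (σ : ℝ) (v : NNReal) (hvs : (v : ℝ) = σ ^ 2) (hσ : 0 < σ) (t u : ℝ) (hu : u < 0) :
      (Measure.pi fun _ : Fin m => gaussianReal 0 v)
          {y : Fin m → ℝ | ∑ i, (y i ^ 2 - σ ^ 2) ≤ t} ≤
        ENNReal.ofReal (Real.exp (m * σ ^ 4 * u ^ 2 - u * t)) := by
  have hprod : ∀ y : Fin m → ℝ, Real.exp (u * ∑ i, (y i ^ 2 - σ ^ 2)) =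
      ∏ i, Real.exp (u * (y i ^ 2 - σ ^ 2)) := by
    intro y; rw [Finset.mul_sum, Real.exp_sum]
  have hint1 : Integrable (fun y : ℝ => Real.exp (u * (y ^ 2 - σ ^ 2)))
      (gaussianReal 0 v) := by
    refine Integrable.of_bound (C := Real.exp (-u * σ ^ 2)) (by fun_prop) ?_
    filter_upwards with y
    rw [Real.norm_eq_abs, Real.abs_exp, Real.exp_le_exp]
    nlinarith [mul_nonneg (neg_nonneg.2 hu.le) (sq_nonneg y)]
  have hint : Integrable (fun y : Fin m → ℝ => Real.exp (u * ∑ i, (y i ^ 2 - σ ^ 2)))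
      (Measure.pi fun _ : Fin m => gaussianReal 0 v) := by
    simp_rw [hprod]
    exact Integrable.fintype_prod (fun _ => hint1)
  have h := measure_le_le_exp_mul_mgf (X := fun y : Fin m → ℝ => ∑ i, (y i ^ 2 - σ ^ 2))
    t hu.le hint
  rw [← ENNReal.ofReal_toReal (measure_ne_top (Measure.pi fun _ : Fin m => gaussianReal 0 v) {y : Fin m → ℝ | ∑ i, (y i ^ 2 - σ ^ 2) ≤ t})]
  refine ENNReal.ofReal_le_ofReal (h.trans ?_)
  rw [mgf]
  simp_rw [hprod]
  rw [integral_fintype_prod_eq_pow (fun y : ℝ => Real.exp (u * (y ^ 2 - σ ^ 2))), Fintype.card_fin]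
  calc _ ≤ Real.exp (-u * t) * (Real.exp (σ ^ 4 * u ^ 2)) ^ m := by
        gcongr
        · exact aux_int σ u v hvs hσ hu
    _ = _ := by
        rw [← Real.exp_nat_mul, ← Real.exp_add]; congr 1; ring

/-- Laplace-transform tail bound for a sum of centered squares
of i.i.d. Gaussians (generalization of Laurent–Massart, Lemma 1). -/
theorem statement8 (m : ℕ) (σ : ℝ) (hσ : 0 < σ) :
    (∀ t : ℝ, ∀ u : ℝ, -(1 / (2 * σ ^ 2)) < u → u < 0 →
      (Measure.pi fun _ : Fin m => gaussianReal 0 ⟨σ ^ 2, sq_nonneg σ⟩)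
          {y : Fin m → ℝ | ∑ i, (y i ^ 2 - σ ^ 2) ≤ t} ≤
        ENNReal.ofReal (Real.exp (m * σ ^ 4 * u ^ 2 - u * t))) ∧
    (∀ x : ℝ, 0 < x → x < (m : ℝ) / 4 →
      (Measure.pi fun _ : Fin m => gaussianReal 0 ⟨σ ^ 2, sq_nonneg σ⟩)
          {y : Fin m → ℝ | ∑ i, (y i ^ 2 - σ ^ 2) ≤ -2 * σ ^ 2 * Real.sqrt (m * x)} ≤
        ENNReal.ofReal (Real.exp (-x))) := by
  refine ⟨fun t u _ hu => aux_i m σ ⟨σ ^ 2, sq_nonneg σ⟩ rfl hσ t u hu, fun x hx hxm => ?_⟩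
  have hm : (0 : ℝ) < m := by linarith
  have hs : 0 < √(m * x) := Real.sqrt_pos.mpr (by positivity)
  have hu : -(√(m * x) / (m * σ ^ 2)) < 0 := by
    have : 0 < √(m * x) / (m * σ ^ 2) := by positivity
    linarith
  have h := aux_i m σ ⟨σ ^ 2, sq_nonneg σ⟩ rfl hσ (-2 * σ ^ 2 * √(m * x)) _ hu
  have hsq : √(m * x) ^ 2 = m * x := Real.sq_sqrt (by positivity)
  have he : m * σ ^ 4 * (-(√(m * x) / (m * σ ^ 2))) ^ 2 -
      -(√(m * x) / (m * σ ^ 2)) * (-2 * σ ^ 2 * √(m * x)) = -x := by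
    have : m * σ ^ 4 * (-(√(m * x) / (m * σ ^ 2))) ^ 2 -
      -(√(m * x) / (m * σ ^ 2)) * (-2 * σ ^ 2 * √(m * x)) = - (√(m * x) ^ 2 / m) := by
      field_simp
      ring
    rw [this, hsq]; field_simp
  rw [he] at h
  exact h

end
end

section
/- Let A = [a₁,…,a_n] ∈ ℝ^{m×n} be a random matrix whose entries are i.i.d. real Gaussian with mean 0 and variance σ², and set b_i := a_i / ‖a_i‖₂ for i ∈ {1,…,n}. If m > 4c ln n for a constant c > 0, then for any fixed i ≠ j in {1,…,n}, with probability greater than 1 − 4 n^{−c} one has |⟨b_i, b_j⟩| < ( c σ² ln n + √( (c σ² ln n)² + 4 c σ⁴ m ln n ) ) / ( m ( σ² − √( 4 c σ⁴ (ln n) / m ) ) ). -/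
open MeasureTheory ProbabilityTheory
noncomputable section


lemma aux_sq (v : NNReal) (hv : v ≠ 0) (s : ℝ) (hs : 2 * s * v < 1) :
    ∫⁻ x, ENNReal.ofReal (Real.exp (s * x ^ 2)) ∂(gaussianReal 0 v)
      = ENNReal.ofReal (Real.sqrt (1 / (1 - 2 * s * v))) := by
  have hv0 : (0 : ℝ) < v := by positivity
  rw [gaussianReal_of_var_ne_zero 0 hv, lintegral_withDensity_eq_lintegral_mul _ (measurable_gaussianPDF 0 v) (by fun_prop)]
  have hb : 0 < 1 / (2 * (v:ℝ)) - s := by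
    rw [sub_pos, lt_div_iff₀ (by positivity)]; linarith
  have h1 : ∀ x : ℝ, (gaussianPDF 0 v * fun x => ENNReal.ofReal (Real.exp (s * x ^ 2))) x
      = ENNReal.ofReal ((Real.sqrt (2 * Real.pi * v))⁻¹ * Real.exp (-(1 / (2 * (v:ℝ)) - s) * x ^ 2)) := by
    intro x
    rw [Pi.mul_apply, gaussianPDF, ← ENNReal.ofReal_mul (gaussianPDFReal_nonneg _ _ _), gaussianPDFReal_def]
    simp only
    rw [mul_assoc, ← Real.exp_add]
    congr 3
    field_simp
    ring
  simp_rw [h1]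
  rw [← ofReal_integral_eq_lintegral_ofReal ((integrable_exp_neg_mul_sq hb).const_mul _)
    (Filter.Eventually.of_forall fun x => by positivity), integral_const_mul, integral_gaussian,
    ← Real.sqrt_inv, ← Real.sqrt_mul (by positivity)]
  congr 2
  have : 1 - 2 * s * v ≠ 0 := by linarith
  have : 1 / (2 * (v:ℝ)) - s = (1 - 2 * s * v) / (2 * v) := by field_simp
  rw [this]
  field_simp

lemma aux_lin (v : NNReal) (s : ℝ) :
    ∫⁻ x, ENNReal.ofReal (Real.exp (s * x)) ∂(gaussianReal 0 v)
      = ENNReal.ofReal (Real.exp (v * s ^ 2 / 2)) := by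
  rw [← ofReal_integral_eq_lintegral_ofReal (integrable_exp_mul_gaussianReal s)
    (Filter.Eventually.of_forall fun x => by positivity)]
  have := mgf_gaussianReal (p := gaussianReal 0 v) (X := id) (μ := 0) (v := v) (by simp) s
  simp [mgf] at this
  rw [this]

lemma aux_prod (v : NNReal) (hv : v ≠ 0) (s : ℝ) (hs : (s * v) ^ 2 < 1) :
    ∫⁻ p, ENNReal.ofReal (Real.exp (s * (p.1 * p.2))) ∂((gaussianReal 0 v).prod (gaussianReal 0 v))
      = ENNReal.ofReal (Real.sqrt (1 / (1 - (s * v) ^ 2))) := by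
  rw [lintegral_prod _ (by fun_prop)]
  have : ∀ x y : ℝ, s * (x * y) = (s * x) * y := by intros; ring
  simp_rw [this, aux_lin]
  have : ∀ x : ℝ, v * (s * x) ^ 2 / 2 = (v * s ^ 2 / 2) * x ^ 2 := by intros; ring
  simp_rw [this]
  rw [aux_sq v hv _ (by nlinarith)]
  congr 4
  ring

lemma aux_chernoff {R : Type*} [MeasurableSpace R] (ν : Measure R) [IsProbabilityMeasure ν] (m : ℕ)
    (f : R → ℝ) (hf : Measurable f) (K a : ℝ) (hK : 0 ≤ K)
    (h : ∫⁻ x, ENNReal.ofReal (Real.exp (f x)) ∂ν = ENNReal.ofReal K) :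
    (Measure.pi fun _ : Fin m => ν) {A | a ≤ ∑ r, f (A r)} ≤ ENNReal.ofReal (K ^ m * Real.exp (-a)) := by
  have hi : ∫⁻ A, ENNReal.ofReal (Real.exp (∑ r, f (A r))) ∂(Measure.pi fun _ : Fin m => ν)
      = ENNReal.ofReal (K ^ m) := by
    have hint : Integrable (fun x => Real.exp (f x)) ν :=
      ⟨by fun_prop, by
        rw [hasFiniteIntegral_iff_ofReal (Filter.Eventually.of_forall fun x => by positivity), h]
        exact ENNReal.ofReal_lt_top⟩
    have hval : ∫ x, Real.exp (f x) ∂ν = K := by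
      rw [integral_eq_lintegral_of_nonneg_ae (Filter.Eventually.of_forall fun x => by positivity) (by fun_prop), h, ENNReal.toReal_ofReal hK]
    simp_rw [Real.exp_sum]
    rw [← ofReal_integral_eq_lintegral_ofReal (Integrable.fintype_prod (f := fun _ : Fin m => fun x => Real.exp (f x)) (fun _ => hint))
      (Filter.Eventually.of_forall fun x => by positivity)]
    rw [integral_fintype_prod_eq_prod (fun _ : Fin m => fun x => Real.exp (f x))]
    simp [hval]
  have := meas_ge_le_lintegral_div (μ := Measure.pi fun _ : Fin m => ν) (f := fun A => ENNReal.ofReal (Real.exp (∑ r, f (A r))))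
    (Measurable.aemeasurable (by fun_prop)) (ε := ENNReal.ofReal (Real.exp a)) (by simp [Real.exp_pos]) ENNReal.ofReal_ne_top
  rw [hi, ← ENNReal.ofReal_div_of_pos (Real.exp_pos a)] at this
  refine le_trans (measure_mono ?_) (this.trans_eq ?_)
  · intro A hA
    exact ENNReal.ofReal_le_ofReal (Real.exp_le_exp.2 hA)
  · rw [Real.exp_neg]; rfl

lemma aux_map2 (n : ℕ) (v : NNReal) (i j : Fin n) (hij : i ≠ j) :
    (Measure.pi fun _ : Fin n => gaussianReal 0 v).map (fun x => (x i, x j))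
      = (gaussianReal 0 v).prod (gaussianReal 0 v) := by
  have h := (iIndepFun_pi (μ := fun _ : Fin n => gaussianReal 0 v) (X := fun _ => id) (fun _ => aemeasurable_id)).indepFun hij
  have h2 := (indepFun_iff_map_prod_eq_prod_map_map (measurable_pi_apply i).aemeasurable (measurable_pi_apply j).aemeasurable).1 h
  rw [h2]
  congr 1
  · exact (measurePreserving_eval (fun _ : Fin n => gaussianReal 0 v) i).map_eq
  · exact (measurePreserving_eval (fun _ : Fin n => gaussianReal 0 v) j).map_eq

lemma aux_norm (m n : ℕ) (v : NNReal) (hv : v ≠ 0) (i : Fin n) (t : ℝ) (ht : 0 < t) (hm : 4 * t < m) :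
    (Measure.pi fun _ : Fin m => Measure.pi fun _ : Fin n => gaussianReal 0 v)
      {A | ∑ r, A r i ^ 2 ≤ m * v - 2 * v * Real.sqrt (m * t)} ≤ ENNReal.ofReal (Real.exp (-t)) := by
  have hv0 : (0 : ℝ) < v := by positivity
  have hm0 : (0 : ℝ) < m := by linarith
  set l := Real.sqrt (t / m) with hl
  have hl0 : 0 < l := by positivity
  have hl2 : l ^ 2 = t / m := Real.sq_sqrt (by positivity)
  have hml : Real.sqrt (m * t) = m * l := by
    rw [Real.sqrt_eq_iff_eq_sq (by positivity) (by positivity), mul_pow, hl2]; field_simp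
  have h1 : ∫⁻ x : Fin n → ℝ, ENNReal.ofReal (Real.exp (-(l / v) * x i ^ 2)) ∂(Measure.pi fun _ : Fin n => gaussianReal 0 v)
      = ENNReal.ofReal (Real.sqrt (1 / (1 + 2 * l))) := by
    have := (measurePreserving_eval (fun _ : Fin n => gaussianReal 0 v) i).lintegral_comp
      (f := fun x => ENNReal.ofReal (Real.exp (-(l / v) * x ^ 2))) (by fun_prop)
    simp only [Function.eval] at this
    rw [this, aux_sq v hv _ (by field_simp; linarith)]
    congr 3
    field_simp
    ring
  have h2 := aux_chernoff _ m (fun x : Fin n → ℝ => -(l / v) * x i ^ 2) (by fun_prop) _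
    (-(l / v) * (m * v - 2 * v * Real.sqrt (m * t))) (Real.sqrt_nonneg _) h1
  refine le_trans (measure_mono ?_) (h2.trans (ENNReal.ofReal_le_ofReal ?_))
  · intro A hA
    simp only [Set.mem_ofPred_eq] at hA ⊢
    rw [← Finset.mul_sum]
    have : 0 < l / v := by positivity
    nlinarith
  · have hK : Real.sqrt (1 / (1 + 2 * l)) ≤ Real.exp (-l + l ^ 2) := by
      rw [Real.sqrt_le_left (by positivity), ← Real.exp_nat_mul, one_div, inv_le_comm₀ (by positivity) (by positivity), ← Real.exp_neg]
      rw [← Real.le_log_iff_exp_le (by positivity)]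
      refine le_trans ?_ (Real.le_log_one_add_of_nonneg (by positivity : 0 ≤ 2 * l))
      rw [le_div_iff₀ (by positivity)]
      push_cast
      nlinarith [pow_pos hl0 3]
    calc _ ≤ Real.exp (-l + l ^ 2) ^ m * Real.exp (-(-(l / v) * (m * v - 2 * v * Real.sqrt (m * t)))) := by gcongr
      _ = Real.exp (-t) := by
        rw [← Real.exp_nat_mul, ← Real.exp_add, hml]
        congr 1
        have : t = m * l ^ 2 := by rw [hl2]; field_simp
        rw [this]
        field_simp
        ring

lemma aux_inner (m n : ℕ) (v : NNReal) (hv : v ≠ 0) (i j : Fin n) (hij : i ≠ j) (t : ℝ) (ht : 0 < t)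
    (hm0 : (0 : ℝ) < m) (e : ℝ) (he : e ^ 2 = 1) :
    (Measure.pi fun _ : Fin m => Measure.pi fun _ : Fin n => gaussianReal 0 v)
      {A | v * (t + Real.sqrt (t ^ 2 + 4 * t * m)) ≤ e * ∑ r, A r i * A r j}
      ≤ ENNReal.ofReal (Real.exp (-(3 * t / 2))) := by
  have hv0 : (0 : ℝ) < v := by positivity
  set y := t + Real.sqrt (t ^ 2 + 4 * t * m) with hy
  have hy0 : 0 < y := by positivity
  have hyt : y ^ 2 = 2 * t * (y + 2 * m) := by
    have := Real.sq_sqrt (by positivity : 0 ≤ t ^ 2 + 4 * t * m)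
    have h : Real.sqrt (t ^ 2 + 4 * t * m) = y - t := by rw [hy]; ring
    rw [h] at this
    linarith
  set s := y / (y + 2 * m) with hs
  have hs0 : 0 < s := by positivity
  have hs1 : s < 1 := by rw [hs, div_lt_one (by positivity)]; linarith
  have hsy : s * y = 2 * t := by rw [hs]; field_simp; linarith
  have hsm : m * s = (1 - s) * y / 2 := by rw [hs]; field_simp; ring
  have h1 : ∫⁻ x : Fin n → ℝ, ENNReal.ofReal (Real.exp (e * s / v * (x i * x j))) ∂(Measure.pi fun _ : Fin n => gaussianReal 0 v)
      = ENNReal.ofReal (Real.sqrt (1 / (1 - s ^ 2))) := by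
    have hsq : (e * s / v * v) ^ 2 = s ^ 2 := by
      rw [div_mul_cancel₀ _ hv0.ne', mul_pow, he, one_mul]
    have := aux_prod v hv (e * s / v) (by rw [hsq]; nlinarith)
    rw [hsq, ← aux_map2 n v i j hij, lintegral_map (by fun_prop) (by fun_prop)] at this
    exact this
  have h2 := aux_chernoff _ m (fun x : Fin n → ℝ => e * s / v * (x i * x j)) (by fun_prop) _
    (s * y) (Real.sqrt_nonneg _) h1
  refine le_trans (measure_mono ?_) (h2.trans (ENNReal.ofReal_le_ofReal ?_))
  · intro A hA
    simp only [Set.mem_ofPred_eq] at hA ⊢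
    rw [← Finset.mul_sum]
    have : e * s / v * ∑ r, A r i * A r j = s / v * (e * ∑ r, A r i * A r j) := by ring
    rw [this]
    calc s * y = s / v * (v * y) := by field_simp
      _ ≤ _ := by gcongr
  · have h1s : 0 < 1 - s ^ 2 := by nlinarith
    have hK : Real.sqrt (1 / (1 - s ^ 2)) ≤ Real.exp (s ^ 2 / (2 * (1 - s))) := by
      rw [Real.sqrt_le_left (by positivity), ← Real.exp_nat_mul]
      refine le_trans ?_ (Real.add_one_le_exp _)
      have h1s' : 0 < 1 - s := by linarith
      have : (1 / (1 - s ^ 2)) = s ^ 2 / ((1 - s) * (1 + s)) + 1 := by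
        have : 1 - s ^ 2 = (1 - s) * (1 + s) := by ring
        rw [this]; field_simp; ring
      rw [this]
      have : ((2:ℕ):ℝ) * (s ^ 2 / (2 * (1 - s))) = s ^ 2 / ((1 - s) * 1) := by push_cast; field_simp
      rw [this]
      gcongr
      linarith
    calc _ ≤ Real.exp (s ^ 2 / (2 * (1 - s))) ^ m * Real.exp (-(s * y)) := by gcongr
      _ = Real.exp (-(3 * t / 2)) := by
        rw [← Real.exp_nat_mul, ← Real.exp_add]
        congr 1
        have h1s' : 1 - s ≠ 0 := by linarith
        have : m * (s ^ 2 / (2 * (1 - s))) = s * y / 4 := by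
          have : m * (s ^ 2 / (2 * (1 - s))) = (m * s) * (s / (2 * (1 - s))) := by ring
          rw [this, hsm]; field_simp; ring
        rw [this, hsy]; ring

theorem statement15 (m n : ℕ) (σ : ℝ) (hσ : 0 < σ) (c : ℝ) (hc : 0 < c)
    (hm : 4 * c * Real.log n < (m : ℝ)) (i j : Fin n) (hij : i ≠ j) :
    1 - 4 * (n : ℝ) ^ (-c) <
      ((Measure.pi fun _ : Fin m => Measure.pi fun _ : Fin n =>
          gaussianReal 0 ⟨σ ^ 2, sq_nonneg σ⟩)
        {A : Matrix (Fin m) (Fin n) ℝ |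
          |∑ r, (A r i / Real.sqrt (∑ r', A r' i ^ 2)) *
              (A r j / Real.sqrt (∑ r', A r' j ^ 2))| <
            (c * σ ^ 2 * Real.log n +
                Real.sqrt ((c * σ ^ 2 * Real.log n) ^ 2 +
                  4 * c * σ ^ 4 * m * Real.log n)) /
              (m * (σ ^ 2 - Real.sqrt (4 * c * σ ^ 4 * Real.log n / m)))}).toReal := by
  have hn : 1 < n := by
    rcases i with ⟨i, hi⟩
    rcases j with ⟨j, hj⟩
    have : i ≠ j := fun h => hij (by simp [h])
    omega
  have hn' : (1 : ℝ) < n := by exact_mod_cast hn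
  have hlog : 0 < Real.log n := Real.log_pos hn'
  set t := c * Real.log n with ht
  have ht0 : 0 < t := by positivity
  have hm' : 4 * t < m := by rw [ht]; linarith
  have hm0 : (0 : ℝ) < m := by linarith
  have hpow : (n : ℝ) ^ (-c) = Real.exp (-t) := by
    rw [Real.rpow_def_of_pos (by linarith), ht]; congr 1; ring
  set v : NNReal := ⟨σ ^ 2, sq_nonneg σ⟩ with hv
  have hvc : (v : ℝ) = σ ^ 2 := rfl
  have hv0 : v ≠ 0 := by
    intro h
    have : (v : ℝ) = 0 := by rw [h]; rfl
    rw [hvc] at this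
    exact (pow_pos hσ 2).ne' this
  have hnum : c * σ ^ 2 * Real.log n + Real.sqrt ((c * σ ^ 2 * Real.log n) ^ 2 +
      4 * c * σ ^ 4 * m * Real.log n) = v * (t + Real.sqrt (t ^ 2 + 4 * t * m)) := by
    have : (c * σ ^ 2 * Real.log n) ^ 2 + 4 * c * σ ^ 4 * m * Real.log n
      = (σ ^ 2) ^ 2 * (t ^ 2 + 4 * t * m) := by rw [ht]; ring
    rw [this, Real.sqrt_mul (by positivity), Real.sqrt_sq (by positivity), hvc, ht]; ring
  have hden : m * (σ ^ 2 - Real.sqrt (4 * c * σ ^ 4 * Real.log n / m))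
      = m * v - 2 * v * Real.sqrt (m * t) := by
    have : 4 * c * σ ^ 4 * Real.log n / m = (2 * σ ^ 2 / m) ^ 2 * (m * t) := by
      rw [ht]; field_simp; ring
    rw [this, Real.sqrt_mul (by positivity), Real.sqrt_sq (by positivity), hvc]
    field_simp
  have hvpos : (0 : ℝ) < v := by rw [hvc]; positivity
  have hD : 0 < m * v - 2 * v * Real.sqrt (m * t) := by
    have : Real.sqrt (m * t) < m / 2 := by
      rw [Real.sqrt_lt' (by positivity)]; nlinarith
    nlinarith
  rw [hnum, hden, hpow]
  set N := v * (t + Real.sqrt (t ^ 2 + 4 * t * m)) with hN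
  set D := m * v - 2 * v * Real.sqrt (m * t) with hDD
  have hN0 : 0 < N := by positivity
  set μ := (Measure.pi fun _ : Fin m => Measure.pi fun _ : Fin n => gaussianReal 0 v) with hμ
  have e1 := aux_norm m n v hv0 i t ht0 hm'
  have e2 := aux_norm m n v hv0 j t ht0 hm'
  have e3 := aux_inner m n v hv0 i j hij t ht0 hm0 1 (by norm_num)
  have e4 := aux_inner m n v hv0 i j hij t ht0 hm0 (-1) (by norm_num)
  rw [← hμ, ← hDD] at e1 e2
  rw [← hμ, ← hN] at e3 e4
  set E1 : Set (Fin m → Fin n → ℝ) := {A | ∑ r, A r i ^ 2 ≤ D}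
  set E2 : Set (Fin m → Fin n → ℝ) := {A | ∑ r, A r j ^ 2 ≤ D}
  set E3 : Set (Fin m → Fin n → ℝ) := {A | N ≤ 1 * ∑ r, A r i * A r j}
  set E4 : Set (Fin m → Fin n → ℝ) := {A | N ≤ -1 * ∑ r, A r i * A r j}
  have key : (Set.univ : Set (Fin m → Fin n → ℝ)) ⊆ {A : Fin m → Fin n → ℝ |
          |∑ r, (A r i / Real.sqrt (∑ r', A r' i ^ 2)) *
              (A r j / Real.sqrt (∑ r', A r' j ^ 2))| < N / D} ∪ ((E1 ∪ E2) ∪ (E3 ∪ E4)) := by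
    intro A _
    by_contra hcon
    simp only [Set.mem_union, not_or] at hcon
    obtain ⟨h0, ⟨h1, h2⟩, h3, h4⟩ := hcon
    simp only [E1, E2, E3, E4, Set.mem_ofPred_eq, not_le] at h1 h2 h3 h4
    apply h0
    simp only [Set.mem_ofPred_eq]
    have hs : ∑ r, (A r i / Real.sqrt (∑ r', A r' i ^ 2)) * (A r j / Real.sqrt (∑ r', A r' j ^ 2))
      = (∑ r, A r i * A r j) / (Real.sqrt (∑ r', A r' i ^ 2) * Real.sqrt (∑ r', A r' j ^ 2)) := by
      rw [Finset.sum_div]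
      exact Finset.sum_congr rfl fun r _ => by rw [div_mul_div_comm]
    have hd : D ≤ Real.sqrt (∑ r', A r' i ^ 2) * Real.sqrt (∑ r', A r' j ^ 2) := by
      calc D = Real.sqrt D * Real.sqrt D := (Real.mul_self_sqrt hD.le).symm
        _ ≤ _ := by gcongr
    rw [hs, abs_div, abs_of_pos (hD.trans_le hd)]
    have habs : |∑ r, A r i * A r j| < N := by rw [abs_lt]; constructor <;> linarith
    exact div_lt_div₀ habs hd hN0.le hD
  have hu := measure_mono (μ := μ) key
  have hu2 := hu.trans (measure_union_le _ _)
  have hu3 := ENNReal.toReal_mono (by finiteness) hu2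
  rw [measure_univ, ENNReal.toReal_add (by finiteness) (by finiteness), ENNReal.toReal_one] at hu3
  have hb : (μ ((E1 ∪ E2) ∪ (E3 ∪ E4))).toReal ≤ 2 * Real.exp (-t) + 2 * Real.exp (-(3 * t / 2)) := by
    refine ENNReal.toReal_le_of_le_ofReal (by positivity) ?_
    calc _ ≤ (μ E1 + μ E2) + (μ E3 + μ E4) :=
          (measure_union_le _ _).trans (add_le_add (measure_union_le _ _) (measure_union_le _ _))
      _ ≤ (ENNReal.ofReal (Real.exp (-t)) + ENNReal.ofReal (Real.exp (-t))) +
          (ENNReal.ofReal (Real.exp (-(3 * t / 2))) + ENNReal.ofReal (Real.exp (-(3 * t / 2)))) := by gcongr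
      _ = _ := by
        rw [← ENNReal.ofReal_add (by positivity) (by positivity), ← ENNReal.ofReal_add (by positivity) (by positivity),
          ← ENNReal.ofReal_add (by positivity) (by positivity)]
        congr 1; ring
  have hlt : Real.exp (-(3 * t / 2)) < Real.exp (-t) := Real.exp_lt_exp.2 (by linarith)
  have hfin : 1 - 4 * Real.exp (-t) < (μ {A : Fin m → Fin n → ℝ |
          |∑ r, (A r i / Real.sqrt (∑ r', A r' i ^ 2)) *
              (A r j / Real.sqrt (∑ r', A r' j ^ 2))| < N / D}).toReal := by linarith
  exact hfin

end
end
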